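/- arXiv:1401.3191 — 2 statements merged into one kernel-verified Lean document; each statement's English description precedes it below -/
import Mathlib

section
/- Let $\xi_{k,\ell,n}$ ($k,\ell,n \in \mathbb{N}$) be random variables such that for each $n$, the $\sigma$-algebras $\sigma(\xi_{k,\ell,n} : \ell \in \mathbb{N})$, $k \in \mathbb{N}$, are independent, and $\sup_{k,\ell,n} \mathbb{E}[\xi_{k,\ell,n}^8] < \infty$. Let $K_n = nK + o(n)$ and $L_n = nL + o(n)$ be positive integers with $K, L > 0$. Then $n^{-2} \sum_{k=1}^{K_n} \sum_{\ell=1}^{L_n} (\xi_{k,\ell,n}^2 - \mathbb{E}[\xi_{k,\ell,n}^2]) \to 0$ almost surely as $n \to \infty$. -/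
open MeasureTheory ProbabilityTheory Filter

lemma aux_pow_le (x : ℝ) (j m : ℕ) (h : j ≤ 2 * m) : |x ^ j| ≤ 1 + x ^ (2 * m) := by
  have h0 : x ^ (2 * m) = |x| ^ (2 * m) := by
    rw [pow_mul, pow_mul, sq_abs]
  rw [abs_pow, h0]
  rcases le_total |x| 1 with h1 | h1
  · have := pow_le_one₀ (n := j) (abs_nonneg x) h1
    have := pow_nonneg (abs_nonneg x) (2 * m)
    linarith
  · have := pow_le_pow_right₀ h1 h
    linarith

lemma aux_int_pow {Ω : Type*} [MeasurableSpace Ω] {μ : Measure Ω} [IsProbabilityMeasure μ]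
    {f : Ω → ℝ} (hf : Measurable f) (j m : ℕ) (h : j ≤ 2 * m)
    (hi : Integrable (fun ω => f ω ^ (2 * m)) μ) : Integrable (fun ω => f ω ^ j) μ := by
  refine Integrable.mono' ((integrable_const (1 : ℝ)).add hi)
    (hf.pow_const j).aestronglyMeasurable (Eventually.of_forall fun ω => ?_)
  simpa using aux_pow_le (f ω) j m h

lemma aux_add_pow_four (a b : ℝ) : (a + b) ^ 4 ≤ 8 * (a ^ 4 + b ^ 4) := by
  have h1 : (a + b) ^ 2 ≤ 2 * (a ^ 2 + b ^ 2) := by nlinarith [sq_nonneg (a - b)]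
  have h2 : ((a + b) ^ 2) ^ 2 ≤ (2 * (a ^ 2 + b ^ 2)) ^ 2 :=
    pow_le_pow_left₀ (sq_nonneg _) h1 2
  nlinarith [sq_nonneg (a ^ 2 - b ^ 2)]

lemma aux_step {Ω : Type*} [MeasurableSpace Ω] {μ : Measure Ω} [IsProbabilityMeasure μ]
    (S Y : Ω → ℝ) (hSm : Measurable S) (hYm : Measurable Y) (hSY : IndepFun S Y μ)
    (hS4 : Integrable (fun ω => S ω ^ 4) μ) (hY4 : Integrable (fun ω => Y ω ^ 4) μ)
    (hS0 : ∫ ω, S ω ∂μ = 0) (hY0 : ∫ ω, Y ω ∂μ = 0) (b c : ℝ) (hb : 0 ≤ b) (hc : 0 ≤ c)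
    (hYb2 : ∫ ω, Y ω ^ 2 ∂μ ≤ b) (hYb4 : ∫ ω, Y ω ^ 4 ∂μ ≤ b ^ 2)
    (hSb2 : ∫ ω, S ω ^ 2 ∂μ ≤ c * b) (hSb4 : ∫ ω, S ω ^ 4 ∂μ ≤ 3 * c ^ 2 * b ^ 2) :
    Integrable (fun ω => (Y ω + S ω) ^ 4) μ ∧ ∫ ω, (Y ω + S ω) ∂μ = 0 ∧
    ∫ ω, (Y ω + S ω) ^ 2 ∂μ ≤ (c + 1) * b ∧
    ∫ ω, (Y ω + S ω) ^ 4 ∂μ ≤ 3 * (c + 1) ^ 2 * b ^ 2 := by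
  have iS : ∀ j, j ≤ 4 → Integrable (fun ω => S ω ^ j) μ :=
    fun j hj => aux_int_pow hSm j 2 hj hS4
  have iY : ∀ j, j ≤ 4 → Integrable (fun ω => Y ω ^ j) μ :=
    fun j hj => aux_int_pow hYm j 2 hj hY4
  have hI : ∀ p q : ℕ, IndepFun (fun ω => S ω ^ p) (fun ω => Y ω ^ q) μ := fun p q =>
    hSY.comp (φ := fun x : ℝ => x ^ p) (ψ := fun x : ℝ => x ^ q)
      (measurable_id.pow_const p) (measurable_id.pow_const q)
  have iSY : ∀ p q : ℕ, p ≤ 4 → q ≤ 4 → Integrable (fun ω => S ω ^ p * Y ω ^ q) μ :=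
    fun p q hp hq => (hI p q).integrable_mul (iS p hp) (iY q hq)
  have eSY : ∀ p q : ℕ, ∫ ω, S ω ^ p * Y ω ^ q ∂μ = (∫ ω, S ω ^ p ∂μ) * ∫ ω, Y ω ^ q ∂μ :=
    fun p q => (hI p q).integral_fun_mul_eq_mul_integral
      (hSm.pow_const p).aestronglyMeasurable (hYm.pow_const q).aestronglyMeasurable
  have iS1 : Integrable S μ := by simpa using iS 1 (by norm_num)
  have iY1 : Integrable Y μ := by simpa using iY 1 (by norm_num)
  have x2 : (fun ω => (Y ω + S ω) ^ 2) =
      fun ω => S ω ^ 2 + (2 * (S ω ^ 1 * Y ω ^ 1) + Y ω ^ 2) := by ext ω; ring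
  have x4 : (fun ω => (Y ω + S ω) ^ 4) =
      fun ω => S ω ^ 4 + (4 * (S ω ^ 3 * Y ω ^ 1) + (6 * (S ω ^ 2 * Y ω ^ 2) +
        (4 * (S ω ^ 1 * Y ω ^ 3) + Y ω ^ 4))) := by ext ω; ring
  have i1 := (iSY 1 1 (by norm_num) (by norm_num)).const_mul 2
  have i2 := (iSY 3 1 (by norm_num) (by norm_num)).const_mul 4
  have i3 := (iSY 2 2 (by norm_num) (by norm_num)).const_mul 6
  have i4 := (iSY 1 3 (by norm_num) (by norm_num)).const_mul 4
  have j4 := i4.fun_add hY4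
  have j3 := i3.fun_add j4
  have j2 := i2.fun_add j3
  have nS2 : 0 ≤ ∫ ω, S ω ^ 2 ∂μ := integral_nonneg fun ω => sq_nonneg _
  have nY2 : 0 ≤ ∫ ω, Y ω ^ 2 ∂μ := integral_nonneg fun ω => sq_nonneg _
  refine ⟨?_, ?_, ?_, ?_⟩
  · rw [x4]; exact hS4.add j2
  · rw [integral_add iY1 iS1, hS0, hY0, add_zero]
  · rw [x2, integral_add (iS 2 (by norm_num)) (i1.fun_add (iY 2 (by norm_num))),
      integral_add i1 (iY 2 (by norm_num)), integral_const_mul, eSY]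
    simp only [pow_one, hS0, hY0]
    linarith
  · rw [x4, integral_add hS4 j2]
    rw [integral_add i2 j3, integral_add i3 j4, integral_add i4 hY4]
    simp only [integral_const_mul, eSY]
    simp only [pow_one, hS0, hY0]
    have := mul_le_mul hSb2 hYb2 nY2 (by positivity)
    nlinarith [sq_nonneg b]

lemma aux_fourth {Ω : Type*} [MeasurableSpace Ω] {μ : Measure Ω} [IsProbabilityMeasure μ]
    (X : ℕ → Ω → ℝ) (hX : ∀ k, Measurable (X k)) (hind : iIndepFun X μ)
    (h4 : ∀ k, Integrable (fun ω => X k ω ^ 4) μ)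
    (h0 : ∀ k, ∫ ω, X k ω ∂μ = 0) (b : ℝ)
    (hb2 : ∀ k, ∫ ω, X k ω ^ 2 ∂μ ≤ b) (hb4 : ∀ k, ∫ ω, X k ω ^ 4 ∂μ ≤ b ^ 2)
    (s : Finset ℕ) :
    Integrable (fun ω => (∑ k ∈ s, X k ω) ^ 4) μ ∧ ∫ ω, (∑ k ∈ s, X k ω) ∂μ = 0 ∧
    ∫ ω, (∑ k ∈ s, X k ω) ^ 2 ∂μ ≤ s.card * b ∧
    ∫ ω, (∑ k ∈ s, X k ω) ^ 4 ∂μ ≤ 3 * s.card ^ 2 * b ^ 2 := by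
  classical
  have hb : 0 ≤ b := le_trans (integral_nonneg fun ω => sq_nonneg _) (hb2 0)
  induction s using Finset.induction_on with
  | empty => simp
  | insert i s hi ih =>
    obtain ⟨hS4, hS0, hSb2, hSb4⟩ := ih
    simp only [Finset.sum_insert hi, Finset.card_insert_of_notMem hi]
    have hSY : IndepFun (fun ω => ∑ k ∈ s, X k ω) (X i) μ := by
      have := hind.indepFun_finsetSum_of_notMem hX hi
      convert this using 1
      ext ω; simp
    have hSm : Measurable (fun ω => ∑ k ∈ s, X k ω) :=
      Finset.measurable_sum _ fun k _ => hX k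
    have := aux_step _ _ hSm (hX i) hSY hS4 (h4 i) hS0 (h0 i) b s.card hb (Nat.cast_nonneg _)
      (hb2 i) (hb4 i) hSb2 hSb4
    push_cast
    exact this

lemma aux_sum_pow_four (s : Finset ℕ) (f : ℕ → ℝ) :
    (∑ i ∈ s, f i) ^ 4 ≤ (s.card : ℝ) ^ 3 * ∑ i ∈ s, f i ^ 4 := by
  have h1 := sq_sum_le_card_mul_sum_sq (s := s) (f := f)
  have h2 := sq_sum_le_card_mul_sum_sq (s := s) (f := fun i => f i ^ 2)
  have h3 := pow_le_pow_left₀ (sq_nonneg _) h1 2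
  calc (∑ i ∈ s, f i) ^ 4 = ((∑ i ∈ s, f i) ^ 2) ^ 2 := by ring
    _ ≤ _ := h3
    _ = (s.card : ℝ) ^ 2 * (∑ i ∈ s, f i ^ 2) ^ 2 := by ring
    _ ≤ (s.card : ℝ) ^ 2 * (s.card * ∑ i ∈ s, (f i ^ 2) ^ 2) := by gcongr
    _ = _ := by simp only [← pow_mul]; ring

/-- Row sums. -/
lemma aux_row {Ω : Type*} [MeasurableSpace Ω] {μ : Measure Ω} [IsProbabilityMeasure μ]
    (Z : ℕ → Ω → ℝ) (hZ : ∀ l, Measurable (Z l))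
    (h4 : ∀ l, Integrable (fun ω => Z l ω ^ 4) μ) (C : ℝ) (hC : 0 ≤ C)
    (hC4 : ∀ l, ∫ ω, Z l ω ^ 4 ∂μ ≤ C) (s : Finset ℕ) :
    Integrable (fun ω => (∑ l ∈ s, Z l ω) ^ 4) μ ∧
    ∫ ω, (∑ l ∈ s, Z l ω) ^ 2 ∂μ ≤ (s.card : ℝ) ^ 2 * (1 + C) ∧
    ∫ ω, (∑ l ∈ s, Z l ω) ^ 4 ∂μ ≤ ((s.card : ℝ) ^ 2 * (1 + C)) ^ 2 := by
  have hm : Measurable (fun ω => ∑ l ∈ s, Z l ω) := Finset.measurable_sum _ fun l _ => hZ l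
  have i4 : Integrable (fun ω => (s.card : ℝ) ^ 3 * ∑ l ∈ s, Z l ω ^ 4) μ :=
    (integrable_finsetSum _ fun l _ => h4 l).const_mul _
  have h2 : ∀ l, Integrable (fun ω => Z l ω ^ 2) μ := fun l =>
    aux_int_pow (hZ l) 2 2 (by norm_num) (h4 l)
  have i2 : Integrable (fun ω => (s.card : ℝ) * ∑ l ∈ s, Z l ω ^ 2) μ :=
    (integrable_finsetSum _ fun l _ => h2 l).const_mul _
  have hC2 : ∀ l, ∫ ω, Z l ω ^ 2 ∂μ ≤ 1 + C := by
    intro l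
    calc ∫ ω, Z l ω ^ 2 ∂μ ≤ ∫ ω, (1 + Z l ω ^ 4) ∂μ :=
          integral_mono (h2 l) ((integrable_const _).add (h4 l))
            fun ω => (le_abs_self _).trans (aux_pow_le (Z l ω) 2 2 (by norm_num))
      _ = 1 + ∫ ω, Z l ω ^ 4 ∂μ := by
          rw [integral_add (integrable_const _) (h4 l)]; simp
      _ ≤ _ := by linarith [hC4 l]
  have I4 : Integrable (fun ω => (∑ l ∈ s, Z l ω) ^ 4) μ := by
    refine Integrable.mono' i4 (hm.pow_const 4).aestronglyMeasurable
      (Eventually.of_forall fun ω => ?_)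
    rw [Real.norm_eq_abs, abs_of_nonneg (by positivity)]
    exact aux_sum_pow_four s fun l => Z l ω
  refine ⟨I4, ?_, ?_⟩
  · calc _ ≤ ∫ ω, (s.card : ℝ) * ∑ l ∈ s, Z l ω ^ 2 ∂μ :=
          integral_mono (aux_int_pow hm 2 2 (by norm_num) I4) i2
            fun ω => sq_sum_le_card_mul_sum_sq
      _ = (s.card : ℝ) * ∑ l ∈ s, ∫ ω, Z l ω ^ 2 ∂μ := by
          rw [integral_const_mul, integral_finsetSum _ fun l _ => h2 l]
      _ ≤ (s.card : ℝ) * ∑ l ∈ s, (1 + C) := by gcongr with l; exact hC2 l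
      _ = _ := by simp; ring
  · calc _ ≤ ∫ ω, (s.card : ℝ) ^ 3 * ∑ l ∈ s, Z l ω ^ 4 ∂μ :=
          integral_mono I4 i4 fun ω => aux_sum_pow_four s fun l => Z l ω
      _ = (s.card : ℝ) ^ 3 * ∑ l ∈ s, ∫ ω, Z l ω ^ 4 ∂μ := by
          rw [integral_const_mul, integral_finsetSum _ fun l _ => h4 l]
      _ ≤ (s.card : ℝ) ^ 3 * ∑ l ∈ s, C := by gcongr with l; exact hC4 l
      _ = (s.card : ℝ) ^ 4 * C := by simp; ring
      _ ≤ (s.card : ℝ) ^ 4 * (1 + C) ^ 2 := by gcongr; nlinarith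
      _ = _ := by ring

/-- Centered squares. -/
lemma aux_center {Ω : Type*} [MeasurableSpace Ω] {μ : Measure Ω} [IsProbabilityMeasure μ]
    (f : Ω → ℝ) (hf : Measurable f) (h8 : Integrable (fun ω => f ω ^ 8) μ) (M : ℝ)
    (hM : ∫ ω, f ω ^ 8 ∂μ ≤ M) :
    Integrable (fun ω => (f ω ^ 2 - ∫ ω', f ω' ^ 2 ∂μ) ^ 4) μ ∧
    ∫ ω, (f ω ^ 2 - ∫ ω', f ω' ^ 2 ∂μ) ∂μ = 0 ∧
    ∫ ω, (f ω ^ 2 - ∫ ω', f ω' ^ 2 ∂μ) ^ 4 ∂μ ≤ 8 * (M + (1 + M) ^ 4) := by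
  have h2 : Integrable (fun ω => f ω ^ 2) μ := aux_int_pow hf 2 4 (by norm_num) h8
  have c0 : 0 ≤ ∫ ω', f ω' ^ 2 ∂μ := integral_nonneg fun ω => sq_nonneg _
  have c1 : ∫ ω', f ω' ^ 2 ∂μ ≤ 1 + M := by
    calc ∫ ω, f ω ^ 2 ∂μ ≤ ∫ ω, (1 + f ω ^ 8) ∂μ :=
          integral_mono h2 ((integrable_const _).add h8)
            fun ω => (le_abs_self _).trans (aux_pow_le (f ω) 2 4 (by norm_num))
      _ = 1 + ∫ ω, f ω ^ 8 ∂μ := by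
          rw [integral_add (integrable_const _) h8]; simp
      _ ≤ _ := by linarith
  have hz : ∫ ω, (f ω ^ 2 - ∫ ω', f ω' ^ 2 ∂μ) ∂μ = 0 := by
    rw [integral_sub h2 (integrable_const _)]; simp
  refine ⟨?_, hz, ?_⟩ <;> clear hz <;> generalize ∫ ω', f ω' ^ 2 ∂μ = c at *
  all_goals
    have key : ∀ ω, (f ω ^ 2 - c) ^ 4 ≤ 8 * (f ω ^ 8 + c ^ 4) := fun ω => by
      have := aux_add_pow_four (f ω ^ 2) (-c)
      calc _ = (f ω ^ 2 + -c) ^ 4 := by ring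
        _ ≤ _ := this
        _ = _ := by ring
    have ib : Integrable (fun ω => 8 * (f ω ^ 8 + c ^ 4)) μ :=
      (h8.add (integrable_const _)).const_mul 8
    have hi : Integrable (fun ω => (f ω ^ 2 - c) ^ 4) μ := by
      refine Integrable.mono' ib
        (((hf.pow_const 2).sub_const c).pow_const 4).aestronglyMeasurable
        (Eventually.of_forall fun ω => ?_)
      rw [Real.norm_eq_abs, abs_of_nonneg (by positivity)]
      exact key ω
  · exact hi
  · calc _ ≤ ∫ ω, 8 * (f ω ^ 8 + c ^ 4) ∂μ := integral_mono hi ib key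
      _ = 8 * (∫ ω, f ω ^ 8 ∂μ + c ^ 4) := by
        rw [integral_const_mul, integral_add h8 (integrable_const _)]; simp
      _ ≤ _ := by gcongr

/-- Borel-Cantelli type step. -/
lemma aux_ae {Ω : Type*} [MeasurableSpace Ω] {μ : Measure Ω}
    (T : ℕ → Ω → ℝ) (hT : ∀ n, Measurable (T n))
    (h4 : ∀ n, Integrable (fun ω => T n ω ^ 4) μ) (u : ℕ → ℝ) (hu : Summable u)
    (hle : ∀ n, ∫ ω, T n ω ^ 4 ∂μ ≤ u n) :
    ∀ᵐ ω ∂μ, Tendsto (fun n => T n ω) atTop (nhds 0) := by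
  have hn : ∀ n ω, 0 ≤ T n ω ^ 4 := fun n ω => by positivity
  have hm : ∀ n, Measurable fun ω => ENNReal.ofReal (T n ω ^ 4) := fun n =>
    ((hT n).pow_const 4).ennreal_ofReal
  have hfin : ∫⁻ ω, ∑' n, ENNReal.ofReal (T n ω ^ 4) ∂μ ≠ ⊤ := by
    rw [lintegral_tsum fun n => (hm n).aemeasurable]
    refine ne_top_of_le_ne_top hu.tsum_ofReal_ne_top (ENNReal.tsum_le_tsum fun n => ?_)
    rw [← ofReal_integral_eq_lintegral_ofReal (h4 n) (Eventually.of_forall (hn n))]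
    exact ENNReal.ofReal_le_ofReal (hle n)
  filter_upwards [ae_lt_top (Measurable.ennreal_tsum hm) hfin] with ω hω
  have h1 := ENNReal.tendsto_atTop_zero_of_tsum_ne_top hω.ne
  have h2 : Tendsto (fun n => T n ω ^ 4) atTop (nhds 0) := by
    have := (ENNReal.tendsto_toReal ENNReal.zero_ne_top).comp h1
    simpa [Function.comp_def, ENNReal.toReal_ofReal, hn] using this
  have h3 := h2.sqrt.sqrt
  simp only [Real.sqrt_zero] at h3
  rw [tendsto_zero_iff_abs_tendsto_zero]
  convert h3 using 2 with n
  rw [show T n ω ^ 4 = (T n ω ^ 2) ^ 2 by ring, Real.sqrt_sq (sq_nonneg _), Real.sqrt_sq_eq_abs]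
  rfl

theorem stmt0
    {Ω : Type*} [MeasureSpace Ω] [IsProbabilityMeasure (ℙ : Measure Ω)]
    (ξ : ℕ → ℕ → ℕ → Ω → ℝ)
    (hmeas : ∀ n k ℓ, Measurable (ξ n k ℓ))
    (hindep : ∀ n, iIndep
      (fun k : ℕ => ⨆ ℓ : ℕ, MeasurableSpace.comap (ξ n k ℓ) (borel ℝ)) ℙ)
    (M : ℝ)
    (hmom : ∀ n k ℓ, ∫ ω, (ξ n k ℓ ω) ^ 8 ∂ℙ ≤ M)
    (hint : ∀ n k ℓ, Integrable (fun ω => (ξ n k ℓ ω) ^ 8) ℙ)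
    (K L : ℝ) (hK : 0 < K) (hL : 0 < L)
    (Kn Ln : ℕ → ℕ) (hKn0 : ∀ n, 0 < Kn n) (hLn0 : ∀ n, 0 < Ln n)
    (hKn : Tendsto (fun n => (Kn n : ℝ) / n) atTop (nhds K))
    (hLn : Tendsto (fun n => (Ln n : ℝ) / n) atTop (nhds L)) :
    ∀ᵐ ω ∂(ℙ : Measure Ω),
      Tendsto (fun n : ℕ =>
        (n : ℝ) ^ (-2 : ℤ) *
          ∑ k ∈ Finset.Icc 1 (Kn n), ∑ ℓ ∈ Finset.Icc 1 (Ln n),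
            ((ξ n k ℓ ω) ^ 2 - ∫ ω', (ξ n k ℓ ω') ^ 2 ∂ℙ))
        atTop (nhds 0) := by
  have hM0 : 0 ≤ M := le_trans (integral_nonneg fun ω => by positivity) (hmom 0 0 0)
  obtain ⟨A, hA⟩ := hKn.bddAbove_range
  obtain ⟨B, hB⟩ := hLn.bddAbove_range
  have hA' : ∀ n, (Kn n : ℝ) / n ≤ A := fun n => hA ⟨n, rfl⟩
  have hB' : ∀ n, (Ln n : ℝ) / n ≤ B := fun n => hB ⟨n, rfl⟩
  have hc := fun n k l => aux_center (ξ n k l) (hmeas n k l) (hint n k l) M (hmom n k l)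
  set C : ℝ := 8 * (M + (1 + M) ^ 4) with hCdef
  have hC : 0 ≤ C := by positivity
  have hZm : ∀ n k l, Measurable fun ω => ξ n k l ω ^ 2 - ∫ ω', ξ n k l ω' ^ 2 ∂ℙ :=
    fun n k l => ((hmeas n k l).pow_const 2).sub_const _
  have hr := fun n k => aux_row (fun l ω => ξ n k l ω ^ 2 - ∫ ω', ξ n k l ω' ^ 2 ∂ℙ)
    (hZm n k) (fun l => (hc n k l).1) C hC (fun l => (hc n k l).2.2) (Finset.Icc 1 (Ln n))
  have hXm : ∀ n k, Measurable fun ω => ∑ l ∈ Finset.Icc 1 (Ln n),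
      (ξ n k l ω ^ 2 - ∫ ω', ξ n k l ω' ^ 2 ∂ℙ) :=
    fun n k => Finset.measurable_sum _ fun l _ => hZm n k l
  have hind : ∀ n, iIndepFun (fun k ω => ∑ l ∈ Finset.Icc 1 (Ln n),
      (ξ n k l ω ^ 2 - ∫ ω', ξ n k l ω' ^ 2 ∂ℙ)) ℙ := by
    intro n
    rw [iIndepFun_iff_iIndep]
    refine iIndep_of_iIndep_of_le (hindep n) fun k => ?_
    rw [← measurable_iff_comap_le]
    refine Finset.measurable_sum _ fun l _ => ?_
    have : Measurable[⨆ ℓ : ℕ, MeasurableSpace.comap (ξ n k ℓ) (borel ℝ)] (ξ n k l) := by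
      rw [measurable_iff_comap_le]
      exact le_iSup (fun ℓ : ℕ => MeasurableSpace.comap (ξ n k ℓ) (borel ℝ)) l
    exact (this.pow_const 2).sub_const _
  have hX0 : ∀ n k, ∫ ω, ∑ l ∈ Finset.Icc 1 (Ln n),
      (ξ n k l ω ^ 2 - ∫ ω', ξ n k l ω' ^ 2 ∂ℙ) ∂ℙ = 0 := by
    intro n k
    rw [integral_finsetSum]
    · exact Finset.sum_eq_zero fun l _ => (hc n k l).2.1
    · intro l _
      exact (aux_int_pow (hmeas n k l) 2 4 (by norm_num) (hint n k l)).sub (integrable_const _)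
  have hf := fun n => aux_fourth _ (hXm n) (hind n) (fun k => (hr n k).1) (hX0 n) _
    (fun k => (hr n k).2.1) (fun k => (hr n k).2.2) (Finset.Icc 1 (Kn n))
  refine aux_ae _ (fun n => ?_) (fun n => ?_)
    (fun n => 3 * (1 + C) ^ 2 * A ^ 2 * B ^ 4 * (1 / (n : ℝ) ^ 2))
    ((Real.summable_one_div_nat_pow.2 (by norm_num)).mul_left _) (fun n => ?_)
  · exact (Finset.measurable_sum _ fun k _ => hXm n k).const_mul _
  · simp only [mul_pow]
    exact (hf n).1.const_mul _
  · simp only [mul_pow]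
    rw [integral_const_mul]
    have h := (hf n).2.2.2
    simp only [Nat.card_Icc, Nat.add_sub_cancel] at h
    rcases Nat.eq_zero_or_pos n with rfl | hn
    · simp
    have hn' : (0 : ℝ) < n := by exact_mod_cast hn
    calc _ ≤ (((n : ℝ) ^ (-2 : ℤ)) ^ 4) * _ := mul_le_mul_of_nonneg_left h (by positivity)
      _ = 3 * (1 + C) ^ 2 * ((Kn n : ℝ) / n) ^ 2 * ((Ln n : ℝ) / n) ^ 4 * (1 / (n : ℝ) ^ 2) := by
        rw [zpow_neg]
        norm_cast
        push_cast
        field_simp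
      _ ≤ _ := by
        have := hA' n
        have := hB' n
        gcongr
end

section
/- Let $\xi_{k,j,n}$ be random variables such that for each $n$ the $\sigma$-algebras $\sigma(\xi_{k,j,n} : k \in \mathbb{N})$, $j \in \mathbb{N}$, are independent, and $\sup_{k,j,n} \mathbb{E}[\xi_{k,j,n}^8] < \infty$. Let $K_n = nK + o(n)$ with $K > 0$. Then $n^{-2} \sum_{k=1}^{K_n} k^{-1} \left[ \left(\sum_{j=1}^{k} \xi_{k,j,n}\right)^2 - \mathbb{E}\left(\sum_{j=1}^{k} \xi_{k,j,n}\right)^2 \right] \to 0$ almost surely as $n \to \infty$. -/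
open MeasureTheory ProbabilityTheory Filter

lemma aux_conv {Ω : Type*} [MeasurableSpace Ω] (μ : Measure Ω) (f : ℕ → Ω → ℝ)
    (hi : ∀ n, Integrable (f n) μ) (h0 : ∀ n ω, 0 ≤ f n ω) (c : ℝ)
    (hb : ∀ n, ∫ ω, f n ω ∂μ ≤ c * ((n : ℝ) ^ 2)⁻¹) :
    ∀ᵐ ω ∂μ, Tendsto (fun n => f n ω) atTop (nhds 0) := by
  have hs : Summable (fun n => ∫ ω, f n ω ∂μ) := by
    refine Summable.of_nonneg_of_le (fun n => integral_nonneg (h0 n)) hb ?_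
    exact (Real.summable_nat_pow_inv.2 (by norm_num)).mul_left c
  have h1 : ∫⁻ ω, ∑' n, ENNReal.ofReal (f n ω) ∂μ ≠ ⊤ := by
    rw [lintegral_tsum (fun n => (hi n).aemeasurable.ennreal_ofReal)]
    have : ∀ n, ∫⁻ ω, ENNReal.ofReal (f n ω) ∂μ = ENNReal.ofReal (∫ ω, f n ω ∂μ) := fun n =>
      (ofReal_integral_eq_lintegral_ofReal (hi n) (ae_of_all _ (h0 n))).symm
    simp_rw [this]
    exact hs.tsum_ofReal_ne_top
  have h2 := ae_lt_top' (AEMeasurable.tsum (fun n => (hi n).aemeasurable.ennreal_ofReal)) h1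
  filter_upwards [h2] with ω hω
  have h3 := ENNReal.tendsto_atTop_zero_of_tsum_ne_top hω.ne
  have h4 := (ENNReal.tendsto_toReal (by simp)).comp h3
  simpa [Function.comp_def, ENNReal.toReal_ofReal (h0 _ ω)] using h4

lemma aux_pow {u : ℕ → ℝ} (p : ℕ) (hp : p ≠ 0)
    (h : Tendsto (fun n => u n ^ p) atTop (nhds 0)) : Tendsto u atTop (nhds 0) := by
  rw [tendsto_zero_iff_abs_tendsto_zero] at h ⊢
  rw [Metric.tendsto_atTop] at h ⊢
  intro ε hε
  obtain ⟨N, hN⟩ := h (ε ^ p) (by positivity)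
  refine ⟨N, fun n hn => ?_⟩
  have := hN n hn
  simp only [Function.comp_apply, abs_pow, dist_zero_right, Real.norm_eq_abs, abs_abs] at this ⊢
  exact lt_of_pow_lt_pow_left₀ p hε.le this

lemma aux_int {Ω : Type*} [MeasurableSpace Ω] {μ : Measure Ω} [IsProbabilityMeasure μ]
    {X : Ω → ℝ} (h : MemLp X 4 μ) (p : ℕ) (hp : p ≤ 4) : Integrable (fun ω => X ω ^ p) μ := by
  have h1 : MemLp X (p : ℕ) μ := h.mono_exponent (by exact_mod_cast hp)
  have := h1.integrable_norm_pow'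
  exact (this.congr' (h.aestronglyMeasurable.pow p) (by simp))

lemma aux_mom {Ω : Type*} [MeasurableSpace Ω] {μ : Measure Ω} [IsProbabilityMeasure μ]
    (X : ℕ → Ω → ℝ) (hm : ∀ j, Measurable (X j)) (hX : ∀ j, MemLp (X j) 4 μ)
    (hind : iIndepFun X μ) (D : ℝ) (hD : 1 ≤ D) (h1 : ∀ j, ∫ ω, X j ω ∂μ = 0)
    (h2 : ∀ j, ∫ ω, X j ω ^ 2 ∂μ ≤ D) (h4 : ∀ j, ∫ ω, X j ω ^ 4 ∂μ ≤ D) (s : Finset ℕ) :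
    MemLp (∑ j ∈ s, X j) 4 μ ∧ ∫ ω, (∑ j ∈ s, X j) ω ∂μ = 0 ∧
    ∫ ω, (∑ j ∈ s, X j) ω ^ 2 ∂μ ≤ D * s.card ∧
    ∫ ω, (∑ j ∈ s, X j) ω ^ 4 ∂μ ≤ 3 * D ^ 2 * (s.card : ℝ) ^ 2 := by
  induction s using Finset.induction_on with
  | empty => simp
  | insert a s ha ih =>
    obtain ⟨iL, i1, i2, i4⟩ := ih
    have hi : IndepFun (∑ j ∈ s, X j) (X a) μ := hind.indepFun_finsetSum_of_notMem hm ha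
    rw [Finset.sum_insert ha, Finset.card_insert_of_notMem ha]
    set S := ∑ j ∈ s, X j with hS
    have hSi := aux_int iL
    have hXi := aux_int (hX a)
    have hpi : ∀ p q : ℕ, IndepFun (fun ω => S ω ^ p) (fun ω => X a ω ^ q) μ := fun p q =>
      hi.comp (measurable_id.pow_const p) (measurable_id.pow_const q)
    have hprod : ∀ p q : ℕ, p ≤ 4 → q ≤ 4 → Integrable (fun ω => S ω ^ p * X a ω ^ q) μ :=
      fun p q hp hq => (hpi p q).integrable_mul (hSi p hp) (hXi q hq)
    have hprodv : ∀ p q : ℕ, p ≤ 4 → q ≤ 4 → ∫ ω, S ω ^ p * X a ω ^ q ∂μ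
        = (∫ ω, S ω ^ p ∂μ) * ∫ ω, X a ω ^ q ∂μ :=
      fun p q hp hq => (hpi p q).integral_fun_mul_eq_mul_integral
        (hSi p hp).aestronglyMeasurable (hXi q hq).aestronglyMeasurable
    have hS1 : ∫ ω, S ω ^ 1 ∂μ = 0 := by simpa using i1
    have hX1 : ∫ ω, X a ω ^ 1 ∂μ = 0 := by simpa using h1 a
    refine ⟨(hX a).add iL, ?_, ?_, ?_⟩
    · have : ∫ ω, (X a + S) ω ∂μ = (∫ ω, X a ω ∂μ) + ∫ ω, S ω ∂μ :=
        integral_add (by simpa using hXi 1 (by norm_num)) (by simpa using hSi 1 (by norm_num))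
      rw [this, h1, i1, add_zero]
    · have e : ∀ ω, (X a + S) ω ^ 2 = X a ω ^ 2 + S ω ^ 2 + 2 * (S ω ^ 1 * X a ω ^ 1) := by
        intro ω; simp only [Pi.add_apply]; ring
      simp_rw [e]
      rw [integral_add ((hXi 2 (by norm_num)).fun_add (hSi 2 (by norm_num)))
        ((hprod 1 1 (by norm_num) (by norm_num)).const_mul 2),
        integral_add (hXi 2 (by norm_num)) (hSi 2 (by norm_num)), integral_const_mul,
        hprodv 1 1 (by norm_num) (by norm_num), hS1]
      push_cast
      linarith [h2 a]
    · have e : ∀ ω, (X a + S) ω ^ 4 = X a ω ^ 4 + S ω ^ 4 + 4 * (S ω ^ 1 * X a ω ^ 3)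
          + 4 * (S ω ^ 3 * X a ω ^ 1) + 6 * (S ω ^ 2 * X a ω ^ 2) := by
        intro ω; simp only [Pi.add_apply]; ring
      simp_rw [e]
      have I1 := (hXi 4 (by norm_num)).fun_add (hSi 4 (by norm_num))
      have J13 := (hprod 1 3 (by norm_num) (by norm_num)).const_mul 4
      have J31 := (hprod 3 1 (by norm_num) (by norm_num)).const_mul 4
      have J22 := (hprod 2 2 (by norm_num) (by norm_num)).const_mul 6
      rw [integral_add ((I1.fun_add J13).fun_add J31) J22, integral_add (I1.fun_add J13) J31,
        integral_add I1 J13,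
        integral_add (hXi 4 (by norm_num)) (hSi 4 (by norm_num)), integral_const_mul,
        integral_const_mul, integral_const_mul,
        hprodv 1 3 (by norm_num) (by norm_num), hprodv 3 1 (by norm_num) (by norm_num),
        hprodv 2 2 (by norm_num) (by norm_num), hS1, hX1]
      have hs0 : 0 ≤ ∫ ω, S ω ^ 2 ∂μ := integral_nonneg fun ω => sq_nonneg _
      have hx0 : 0 ≤ ∫ ω, X a ω ^ 2 ∂μ := integral_nonneg fun ω => sq_nonneg _
      have hm : (∫ ω, S ω ^ 2 ∂μ) * ∫ ω, X a ω ^ 2 ∂μ ≤ (D * s.card) * D :=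
        mul_le_mul i2 (h2 a) hx0 (by positivity)
      push_cast
      nlinarith [h4 a]

lemma aux_sum4 (s : Finset ℕ) (a : ℕ → ℝ) :
    (∑ k ∈ s, a k) ^ 4 ≤ (s.card : ℝ) ^ 3 * ∑ k ∈ s, a k ^ 4 := by
  have h1 : (∑ k ∈ s, a k) ^ 2 ≤ s.card * ∑ k ∈ s, a k ^ 2 := sq_sum_le_card_mul_sum_sq
  have h2 : (∑ k ∈ s, a k ^ 2) ^ 2 ≤ s.card * ∑ k ∈ s, (a k ^ 2) ^ 2 := sq_sum_le_card_mul_sum_sq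
  calc (∑ k ∈ s, a k) ^ 4 = ((∑ k ∈ s, a k) ^ 2) ^ 2 := by ring
    _ ≤ (s.card * ∑ k ∈ s, a k ^ 2) ^ 2 := by gcongr
    _ = (s.card : ℝ) ^ 2 * (∑ k ∈ s, a k ^ 2) ^ 2 := by ring
    _ ≤ (s.card : ℝ) ^ 2 * (s.card * ∑ k ∈ s, (a k ^ 2) ^ 2) := by gcongr
    _ = _ := by simp_rw [← pow_mul]; ring

/-- expectation of the p-th power of a sum -/
lemma aux_Esum {Ω : Type*} [MeasurableSpace Ω] {μ : Measure Ω} [IsProbabilityMeasure μ]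
    (p : ℕ) (hp : p = 2 ∨ p = 4) (N : ℕ) (a : ℕ → Ω → ℝ) (B : ℝ)
    (ham : ∀ k, AEStronglyMeasurable (a k) μ)
    (hi : ∀ k, Integrable (fun ω => a k ω ^ p) μ)
    (hB : ∀ k ∈ Finset.Icc 1 N, ∫ ω, a k ω ^ p ∂μ ≤ B) :
    Integrable (fun ω => (∑ k ∈ Finset.Icc 1 N, a k ω) ^ p) μ ∧
    ∫ ω, (∑ k ∈ Finset.Icc 1 N, a k ω) ^ p ∂μ ≤ (N : ℝ) ^ p * B := by
  have hev : Even p := by rcases hp with rfl | rfl <;> decide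
  have hle : ∀ ω, (∑ k ∈ Finset.Icc 1 N, a k ω) ^ p
      ≤ (N : ℝ) ^ (p - 1) * ∑ k ∈ Finset.Icc 1 N, a k ω ^ p := by
    intro ω
    rcases hp with rfl | rfl
    · simpa using sq_sum_le_card_mul_sum_sq (s := Finset.Icc 1 N) (f := fun k => a k ω)
    · simpa using aux_sum4 (Finset.Icc 1 N) (fun k => a k ω)
  have hI : Integrable (fun ω => (N : ℝ) ^ (p - 1) * ∑ k ∈ Finset.Icc 1 N, a k ω ^ p) μ :=
    (integrable_finsetSum _ fun k _ => hi k).const_mul _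
  have hI2 : Integrable (fun ω => (∑ k ∈ Finset.Icc 1 N, a k ω) ^ p) μ := by
    refine hI.mono' ((Finset.aestronglyMeasurable_fun_sum _ fun k _ => ham k).pow p) ?_
    refine ae_of_all _ fun ω => ?_
    rw [Real.norm_eq_abs, abs_of_nonneg (hev.pow_nonneg _)]
    exact hle ω
  refine ⟨hI2, ?_⟩
  calc _ ≤ ∫ ω, (N : ℝ) ^ (p - 1) * ∑ k ∈ Finset.Icc 1 N, a k ω ^ p ∂μ :=
        integral_mono hI2 hI hle
    _ = (N : ℝ) ^ (p - 1) * ∑ k ∈ Finset.Icc 1 N, ∫ ω, a k ω ^ p ∂μ := by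
        rw [integral_const_mul, integral_finsetSum _ fun k _ => hi k]
    _ ≤ (N : ℝ) ^ (p - 1) * ∑ k ∈ Finset.Icc 1 N, B := by
        gcongr with k hk; exact hB k hk
    _ = (N : ℝ) ^ p * B := by
        rcases hp with rfl | rfl <;> simp <;> ring

lemma aux_main {Ω : Type*} [MeasurableSpace Ω] {μ : Measure Ω} [IsProbabilityMeasure μ]
    (T : ℕ → ℕ → Ω → ℝ) (hT : ∀ n k, MemLp (T n k) 4 μ) (D : ℝ) (hD : 1 ≤ D)
    (h2 : ∀ n k, ∫ ω, T n k ω ^ 2 ∂μ ≤ D * k)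
    (h4 : ∀ n k, ∫ ω, T n k ω ^ 4 ∂μ ≤ 3 * D ^ 2 * (k : ℝ) ^ 2)
    (m : ℕ → ℕ → ℝ) (R : ℝ) (hm : ∀ n k, |m n k| ≤ R * k)
    (Kn : ℕ → ℕ) (L : ℝ) (hL : ∀ n, (Kn n : ℝ) / n ≤ L) :
    ∀ᵐ ω ∂μ, Tendsto (fun n : ℕ => (n : ℝ) ^ (-2 : ℤ) * ∑ k ∈ Finset.Icc 1 (Kn n), (k : ℝ)⁻¹ *
      (T n k ω ^ 2 - (∫ ω', T n k ω' ^ 2 ∂μ) + 2 * m n k * T n k ω)) atTop (nhds 0) := by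
  have hA : ∀ n, _ := fun n => aux_Esum (μ := μ) 2 (Or.inl rfl) (Kn n)
    (fun k ω => (k : ℝ)⁻¹ * (T n k ω ^ 2 - (∫ ω', T n k ω' ^ 2 ∂μ))) (8 * D ^ 2)
    (fun k => (((hT n k).aestronglyMeasurable.pow 2).sub aestronglyMeasurable_const).const_mul _)
    (fun k => by
      have e : ∀ ω, ((k : ℝ)⁻¹ * (T n k ω ^ 2 - (∫ ω', T n k ω' ^ 2 ∂μ))) ^ 2
        = (k : ℝ)⁻¹ ^ 2 * (T n k ω ^ 4 - 2 * (∫ ω', T n k ω' ^ 2 ∂μ) * T n k ω ^ 2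
          + (∫ ω', T n k ω' ^ 2 ∂μ) ^ 2) := by intro ω; ring
      simp_rw [e]
      exact (((aux_int (hT n k) 4 (by norm_num)).sub ((aux_int (hT n k) 2
        (by norm_num)).const_mul _)).add (integrable_const _)).const_mul _)
    (fun k hk => by
      have hk1 : (0 : ℝ) < k := by exact_mod_cast (Finset.mem_Icc.1 hk).1
      have hE0 : 0 ≤ ∫ ω', T n k ω' ^ 2 ∂μ := integral_nonneg fun ω => sq_nonneg _
      have e : ∀ ω, ((k : ℝ)⁻¹ * (T n k ω ^ 2 - (∫ ω', T n k ω' ^ 2 ∂μ))) ^ 2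
        ≤ (k : ℝ)⁻¹ ^ 2 * (T n k ω ^ 4 + (∫ ω', T n k ω' ^ 2 ∂μ) ^ 2) := by
        intro ω
        rw [mul_pow]
        gcongr
        nlinarith [mul_nonneg hE0 (sq_nonneg (T n k ω))]
      calc _ ≤ ∫ ω, (k : ℝ)⁻¹ ^ 2 * (T n k ω ^ 4 + (∫ ω', T n k ω' ^ 2 ∂μ) ^ 2) ∂μ := by
            refine integral_mono_of_nonneg (ae_of_all _ fun ω => sq_nonneg _) ?_ (ae_of_all _ e)
            exact ((aux_int (hT n k) 4 (by norm_num)).add (integrable_const _)).const_mul _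
        _ = (k : ℝ)⁻¹ ^ 2 * ((∫ ω, T n k ω ^ 4 ∂μ) + (∫ ω', T n k ω' ^ 2 ∂μ) ^ 2) := by
            rw [integral_const_mul, integral_add (aux_int (hT n k) 4 (by norm_num))
              (integrable_const _)]
            simp
        _ ≤ (k : ℝ)⁻¹ ^ 2 * (3 * D ^ 2 * (k : ℝ) ^ 2 + (D * k) ^ 2) := by
            gcongr
            · exact h4 n k
            · exact h2 n k
        _ = 4 * D ^ 2 := by field_simp; ring
        _ ≤ 8 * D ^ 2 := by nlinarith)
  have hR : 0 ≤ R := by have := (abs_nonneg _).trans (hm 0 1); simpa using this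
  have hB : ∀ n, _ := fun n => aux_Esum (μ := μ) 4 (Or.inr rfl) (Kn n)
    (fun k ω => (k : ℝ)⁻¹ * (2 * m n k * T n k ω)) (16 * R ^ 4 * (3 * D ^ 2 * (Kn n : ℝ) ^ 2))
    (fun k => ((hT n k).aestronglyMeasurable.const_mul _).const_mul _)
    (fun k => by
      simp_rw [mul_pow]
      exact ((aux_int (hT n k) 4 (by norm_num)).const_mul _).const_mul _)
    (fun k hk => by
      have hk1 : (0 : ℝ) < k := by exact_mod_cast (Finset.mem_Icc.1 hk).1
      have hk2 : (k : ℝ) ≤ Kn n := by exact_mod_cast (Finset.mem_Icc.1 hk).2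
      have hm4 : m n k ^ 4 ≤ (R * k) ^ 4 := by
        rw [← Even.pow_abs (by decide : Even 4)]
        exact pow_le_pow_left₀ (abs_nonneg _) (hm n k) 4
      have hT0 : 0 ≤ ∫ ω, T n k ω ^ 4 ∂μ := integral_nonneg fun ω => by positivity
      have e : ∀ ω, ((k : ℝ)⁻¹ * (2 * m n k * T n k ω)) ^ 4
        = ((k : ℝ)⁻¹ ^ 4 * (16 * m n k ^ 4)) * T n k ω ^ 4 := by intro ω; ring
      simp_rw [e]
      rw [integral_const_mul]
      calc _ ≤ ((k : ℝ)⁻¹ ^ 4 * (16 * (R * k) ^ 4)) * (3 * D ^ 2 * (k : ℝ) ^ 2) := by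
            gcongr
            exact h4 n k
        _ = 16 * R ^ 4 * (3 * D ^ 2 * (k : ℝ) ^ 2) := by field_simp
        _ ≤ _ := by gcongr)
  have hz : ∀ n : ℕ, (n : ℝ) ^ (-2 : ℤ) = ((n : ℝ)⁻¹) ^ 2 := by
    intro n; rw [zpow_neg, inv_pow]; norm_cast
  have hL' : ∀ n, (Kn n : ℝ) * (n : ℝ)⁻¹ ≤ L := fun n => by
    have := hL n; rwa [div_eq_mul_inv] at this
  have cA := aux_conv μ (fun n ω => ((n : ℝ) ^ (-2 : ℤ) * ∑ k ∈ Finset.Icc 1 (Kn n),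
      (k : ℝ)⁻¹ * (T n k ω ^ 2 - (∫ ω', T n k ω' ^ 2 ∂μ))) ^ 2)
    (fun n => by simp_rw [mul_pow]; exact (by simpa only [mul_pow] using (hA n).1.const_mul _))
    (fun n ω => sq_nonneg _) (8 * D ^ 2 * L ^ 2) (fun n => by
      simp_rw [fun ω => mul_pow ((n : ℝ) ^ (-2 : ℤ)) (∑ k ∈ Finset.Icc 1 (Kn n),
        (k : ℝ)⁻¹ * (T n k ω ^ 2 - (∫ ω', T n k ω' ^ 2 ∂μ))) 2]
      rw [integral_const_mul, hz]
      calc _ ≤ (((n : ℝ)⁻¹) ^ 2) ^ 2 * ((Kn n : ℝ) ^ 2 * (8 * D ^ 2)) := by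
            gcongr; exact (hA n).2
        _ = 8 * D ^ 2 * ((Kn n : ℝ) * (n : ℝ)⁻¹) ^ 2 * ((n : ℝ)⁻¹) ^ 2 := by ring
        _ ≤ 8 * D ^ 2 * L ^ 2 * ((n : ℝ)⁻¹) ^ 2 := by gcongr; exact hL' n
        _ = _ := by rw [inv_pow])
  have cB := aux_conv μ (fun n ω => ((n : ℝ) ^ (-2 : ℤ) * ∑ k ∈ Finset.Icc 1 (Kn n),
      (k : ℝ)⁻¹ * (2 * m n k * T n k ω)) ^ 4)
    (fun n => by
      simp_rw [fun ω => mul_pow ((n : ℝ) ^ (-2 : ℤ)) (∑ k ∈ Finset.Icc 1 (Kn n),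
        (k : ℝ)⁻¹ * (2 * m n k * T n k ω)) 4]
      exact (hB n).1.const_mul _)
    (fun n ω => by positivity) (48 * R ^ 4 * D ^ 2 * L ^ 6) (fun n => by
      simp_rw [fun ω => mul_pow ((n : ℝ) ^ (-2 : ℤ)) (∑ k ∈ Finset.Icc 1 (Kn n),
        (k : ℝ)⁻¹ * (2 * m n k * T n k ω)) 4]
      rw [integral_const_mul, hz]
      calc _ ≤ (((n : ℝ)⁻¹) ^ 2) ^ 4 *
              ((Kn n : ℝ) ^ 4 * (16 * R ^ 4 * (3 * D ^ 2 * (Kn n : ℝ) ^ 2))) := by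
            gcongr; exact (hB n).2
        _ = 48 * R ^ 4 * D ^ 2 * ((Kn n : ℝ) * (n : ℝ)⁻¹) ^ 6 * ((n : ℝ)⁻¹) ^ 2 := by ring
        _ ≤ 48 * R ^ 4 * D ^ 2 * L ^ 6 * ((n : ℝ)⁻¹) ^ 2 := by gcongr; exact hL' n
        _ = _ := by rw [inv_pow])
  filter_upwards [cA, cB] with ω ha hb
  have := (aux_pow 2 (by norm_num) ha).add (aux_pow 4 (by norm_num) hb)
  rw [add_zero] at this
  refine this.congr fun n => ?_
  rw [← mul_add, ← Finset.sum_add_distrib]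
  congr 1
  exact Finset.sum_congr rfl fun k _ => by ring

theorem stmt4
    {Ω : Type*} [MeasureSpace Ω] [IsProbabilityMeasure (ℙ : Measure Ω)]
    (ξ : ℕ → ℕ → ℕ → Ω → ℝ)  -- ξ n k j
    (hmeas : ∀ n k j, Measurable (ξ n k j))
    (hindep : ∀ n, iIndep
      (fun j : ℕ => ⨆ k : ℕ, MeasurableSpace.comap (ξ n k j) (borel ℝ)) ℙ)
    (M : ℝ)
    (hmom : ∀ n k j, ∫ ω, (ξ n k j ω) ^ 8 ∂ℙ ≤ M)
    (hint : ∀ n k j, Integrable (fun ω => (ξ n k j ω) ^ 8) ℙ)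
    (K : ℝ) (hK : 0 < K)
    (Kn : ℕ → ℕ) (hKn0 : ∀ n, 0 < Kn n)
    (hKn : Tendsto (fun n => (Kn n : ℝ) / n) atTop (nhds K)) :
    ∀ᵐ ω ∂(ℙ : Measure Ω),
      Tendsto (fun n : ℕ =>
        (n : ℝ) ^ (-2 : ℤ) *
          ∑ k ∈ Finset.Icc 1 (Kn n), (k : ℝ)⁻¹ *
            ((∑ j ∈ Finset.Icc 1 k, ξ n k j ω) ^ 2
              - ∫ ω', (∑ j ∈ Finset.Icc 1 k, ξ n k j ω') ^ 2 ∂ℙ))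
        atTop (nhds 0) := by
  have hM : 0 ≤ M := (integral_nonneg fun ω => by positivity).trans (hmom 0 0 0)
  have hL8 : ∀ n k j, MemLp (ξ n k j) 8 ℙ := fun n k j => by
    refine (integrable_norm_rpow_iff (μ := (ℙ : Measure Ω)) (p := 8) (hmeas n k j).aestronglyMeasurable
      (by norm_num) (by norm_num)).1 ?_
    · refine (hint n k j).congr (ae_of_all _ fun ω => ?_)
      have : ((8 : ENNReal).toReal) = ((8 : ℕ) : ℝ) := by norm_num
      simp only [this, Real.rpow_natCast, Real.norm_eq_abs]
      exact (Even.pow_abs (by decide) _).symm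
  have hL4 : ∀ n k j, MemLp (ξ n k j) 4 ℙ := fun n k j =>
    (hL8 n k j).mono_exponent (by norm_num)
  have hI1 : ∀ n k j, Integrable (ξ n k j) ℙ := fun n k j => by
    simpa using aux_int (hL4 n k j) 1 (by norm_num)
  have hmean : ∀ n k j, |∫ ω, ξ n k j ω ∂ℙ| ≤ 1 + M := fun n k j => by
    refine (abs_integral_le_integral_abs).trans ?_
    calc _ ≤ ∫ ω, (1 + ξ n k j ω ^ 8) ∂ℙ := by
          refine integral_mono (hI1 n k j).abs ((integrable_const _).add (hint n k j)) fun ω => ?_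
          have : |ξ n k j ω| ≤ 1 + |ξ n k j ω| ^ 8 := by
            rcases le_total (|ξ n k j ω|) 1 with h | h
            · have : 0 ≤ |ξ n k j ω| ^ 8 := by positivity
              linarith
            · have := le_self_pow₀ h (n := 8) (by norm_num)
              linarith
          rwa [Even.pow_abs (by decide)] at this
      _ = 1 + ∫ ω, ξ n k j ω ^ 8 ∂ℙ := by
          rw [integral_add (integrable_const _) (hint n k j)]; simp
      _ ≤ _ := by linarith [hmom n k j]
  let X : ℕ → ℕ → ℕ → Ω → ℝ := fun n k j ω => ξ n k j ω - ∫ ω', ξ n k j ω' ∂ℙ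
  have hXm : ∀ n k j, Measurable (X n k j) := fun n k j => (hmeas n k j).sub_const _
  have hX4 : ∀ n k j, MemLp (X n k j) 4 ℙ := fun n k j => (hL4 n k j).sub (memLp_const _)
  have hX1 : ∀ n k j, ∫ ω, X n k j ω ∂ℙ = 0 := fun n k j => by
    simp only [X]
    rw [integral_sub (hI1 n k j) (integrable_const _)]; simp
  have hXind : ∀ n k, iIndepFun (X n k) ℙ := fun n k => by
    have h0 : iIndepFun (fun j => ξ n k j) ℙ := by
      rw [iIndepFun_iff_iIndep]
      have h := hindep n
      rw [iIndep_iff] at h ⊢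
      intro s f hf
      refine h s fun i hi => ?_
      have h2 := hf i hi
      exact le_iSup (fun k => MeasurableSpace.comap (ξ n k i) (borel ℝ)) k _ h2
    exact h0.comp (fun j x => x - ∫ ω', ξ n k j ω' ∂ℙ) (fun j => measurable_id.sub_const _)
  let D : ℝ := 1 + (8 * (1 + M) + 8 * (1 + M) ^ 4)
  have hD : 1 ≤ D := by simp only [D]; have : 0 ≤ 1 + M := by linarith
                        have := pow_nonneg this 4
                        linarith
  have hXE4 : ∀ n k j, ∫ ω, X n k j ω ^ 4 ∂ℙ ≤ D - 1 := fun n k j => by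
    have e : ∀ ω, X n k j ω ^ 4 ≤ 8 * (1 + ξ n k j ω ^ 8) + 8 * (1 + M) ^ 4 := fun ω => by
      have h1 : (∫ ω', ξ n k j ω' ∂ℙ) ^ 4 ≤ (1 + M) ^ 4 := by
        rw [← Even.pow_abs (by decide : Even 4)]
        exact pow_le_pow_left₀ (abs_nonneg _) (hmean n k j) 4
      have h2 : ∀ x y : ℝ, (x - y) ^ 4 ≤ 8 * x ^ 4 + 8 * y ^ 4 := fun x y => by
        have a1 : (x - y) ^ 2 ≤ 2 * (x ^ 2 + y ^ 2) := by nlinarith [sq_nonneg (x + y)]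
        have a2 := pow_le_pow_left₀ (sq_nonneg _) a1 2
        nlinarith [sq_nonneg (x ^ 2 - y ^ 2)]
      have h3 : ξ n k j ω ^ 4 ≤ 1 + ξ n k j ω ^ 8 := by
        nlinarith [sq_nonneg (ξ n k j ω ^ 4 - 1), sq_nonneg (ξ n k j ω ^ 4)]
      have := h2 (ξ n k j ω) (∫ ω', ξ n k j ω' ∂ℙ)
      simp only [X]
      linarith
    have I : Integrable (fun ω => 8 * (1 + ξ n k j ω ^ 8)) ℙ :=
      ((integrable_const (1 : ℝ)).add (hint n k j)).const_mul 8
    calc _ ≤ ∫ ω, (8 * (1 + ξ n k j ω ^ 8) + 8 * (1 + M) ^ 4) ∂ℙ :=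
          integral_mono (aux_int (hX4 n k j) 4 le_rfl) (I.add (integrable_const _)) e
      _ = 8 * (1 + ∫ ω, ξ n k j ω ^ 8 ∂ℙ) + 8 * (1 + M) ^ 4 := by
          rw [integral_add I (integrable_const _), integral_const_mul,
            integral_add (integrable_const _) (hint n k j)]
          simp
      _ ≤ D - 1 := by simp only [D]; linarith [hmom n k j]
  have hXE2 : ∀ n k j, ∫ ω, X n k j ω ^ 2 ∂ℙ ≤ D := fun n k j => by
    calc _ ≤ ∫ ω, (1 + X n k j ω ^ 4) ∂ℙ :=
          integral_mono (aux_int (hX4 n k j) 2 (by norm_num))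
            ((integrable_const _).add (aux_int (hX4 n k j) 4 le_rfl))
            (fun ω => by
              show X n k j ω ^ 2 ≤ 1 + X n k j ω ^ 4
              nlinarith [sq_nonneg (X n k j ω ^ 2 - 1), sq_nonneg (X n k j ω ^ 2)])
      _ = 1 + ∫ ω, X n k j ω ^ 4 ∂ℙ := by
          rw [integral_add (integrable_const _) (aux_int (hX4 n k j) 4 le_rfl)]; simp
      _ ≤ D := by linarith [hXE4 n k j]
  have key := fun n k => aux_mom (μ := (ℙ : Measure Ω)) (X n k) (hXm n k) (hX4 n k) (hXind n k)
    D hD (hX1 n k) (hXE2 n k) (fun j => (hXE4 n k j).trans (by linarith)) (Finset.Icc 1 k)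
  obtain ⟨L, hL⟩ := hKn.bddAbove_range
  let m : ℕ → ℕ → ℝ := fun n k => ∑ j ∈ Finset.Icc 1 k, ∫ ω, ξ n k j ω ∂ℙ
  have main := aux_main (μ := (ℙ : Measure Ω)) (fun n k => ∑ j ∈ Finset.Icc 1 k, X n k j)
    (fun n k => (key n k).1) D hD (fun n k => by simpa using (key n k).2.2.1)
    (fun n k => by simpa using (key n k).2.2.2) m (1 + M)
    (fun n k => by
      refine (Finset.abs_sum_le_sum_abs _ _).trans ?_
      refine (Finset.sum_le_sum fun j _ => hmean n k j).trans ?_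
      simp only [Finset.sum_const, Nat.card_Icc, Nat.add_sub_cancel, nsmul_eq_mul]
      rw [mul_comm])
    Kn L (fun n => hL ⟨n, rfl⟩)
  filter_upwards [main] with ω hω
  refine hω.congr fun n => ?_
  congr 1
  refine Finset.sum_congr rfl fun k _ => ?_
  congr 1
  have hS : ∀ ω, ∑ j ∈ Finset.Icc 1 k, ξ n k j ω = (∑ j ∈ Finset.Icc 1 k, X n k j) ω + m n k := by
    intro ω; simp [X, m]
  obtain ⟨kL, k1, -, -⟩ := key n k
  simp_rw [hS]
  set T := ∑ j ∈ Finset.Icc 1 k, X n k j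
  have e : ∀ ω, (T ω + m n k) ^ 2 = T ω ^ 2 + 2 * m n k * T ω + m n k ^ 2 := by intro ω; ring
  have IT2 := aux_int kL 2 (by norm_num)
  have IT1 : Integrable T ℙ := by simpa using aux_int kL 1 (by norm_num)
  have hE : ∫ ω', (T ω' + m n k) ^ 2 ∂ℙ = (∫ ω', T ω' ^ 2 ∂ℙ) + m n k ^ 2 := by
    simp_rw [e]
    rw [integral_add (IT2.fun_add (IT1.const_mul (2 * m n k))) (integrable_const _),
      integral_add IT2 (IT1.const_mul _), integral_const_mul, k1]
    simp
  rw [hE]; ring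
end
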